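/- arXiv:1510.00208 — 6 statements merged into one kernel-verified Lean document; each statement's English description precedes it below -/
import Mathlib

section
/- Let A = (A, X, δ) be a state-finite automaton without outputs and let B be a subautomaton of A. The Rees congruence ρ_B defined by B has a complement in the lattice L(A) of all congruences of A if and only if B is a retract subautomaton of A. -/
/-! Basic notions for state-finite automata without outputs, following M. Fuzesdi,
"Boolean-type retractable state-finite automata without outputs". -/

variable {A X : Type*}

/-- The transition function extended to words: `DeltaStar d a p = δ(a, p)`. -/
def DeltaStar (d : A → X → A) (a : A) (p : List X) : A := p.foldl d a

/-- `B` is (the state set of) a subautomaton of the automaton `(A, X, d)`. -/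
def IsSubaut (d : A → X → A) (B : Set A) : Prop :=
  B.Nonempty ∧ ∀ b ∈ B, ∀ x, d b x ∈ B

/-- `f` (restricted to `B`) is a retract homomorphism of the automaton `B`
onto its subautomaton `C`: it commutes with the transitions on `B`, maps `B` into `C`,
and leaves the elements of `C` fixed (hence is onto `C` whenever `C ⊆ B`). -/
def IsRetractHomOn (d : A → X → A) (B C : Set A) (f : A → A) : Prop :=
  (∀ a ∈ B, ∀ x, f (d a x) = d (f a) x) ∧ (∀ a ∈ B, f a ∈ C) ∧ (∀ c ∈ C, f c = c)

/-- The automaton `B` is retractable: every subautomaton of `B` is a retract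
subautomaton of `B`. -/
def RetractableOn (d : A → X → A) (B : Set A) : Prop :=
  ∀ C, C ⊆ B → IsSubaut d C → ∃ f : A → A, IsRetractHomOn d B C f

/-- The automaton `B` is a Boolean-type retractable automaton: it is retractable and there
is a family of retract homomorphisms `Λ C` of `B` onto `C`, one for each subautomaton `C`
of `B`, such that `C₁ ⊆ C₂` implies `Ker (Λ C₂) ⊆ Ker (Λ C₁)` (kernels taken on `B`). -/
def BooleanTypeOn (d : A → X → A) (B : Set A) : Prop :=
  RetractableOn d B ∧
  ∃ Λ : Set A → (A → A),
    (∀ C, C ⊆ B → IsSubaut d C → IsRetractHomOn d B C (Λ C)) ∧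
    (∀ C₁ C₂, C₁ ⊆ C₂ → C₂ ⊆ B → IsSubaut d C₁ → IsSubaut d C₂ →
      ∀ a ∈ B, ∀ b ∈ B, Λ C₂ a = Λ C₂ b → Λ C₁ a = Λ C₁ b)

/-- The Rees congruence defined by `B`. -/
def ReesRel (B : Set A) : A → A → Prop := fun a b => a = b ∨ (a ∈ B ∧ b ∈ B)

/-- The kernel of a map, as a relation. -/
def KerRel (f : A → A) : A → A → Prop := fun a b => f a = f b

/-- `r` is a congruence of the automaton `(A, X, d)`. -/
def IsCong (d : A → X → A) (r : A → A → Prop) : Prop :=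
  Equivalence r ∧ ∀ a b, r a b → ∀ x, r (d a x) (d b x)

/-- `K` is the kernel of the automaton `B`: a subautomaton of `B` contained in every
subautomaton of `B`. -/
def IsKernelOf (d : A → X → A) (B K : Set A) : Prop :=
  IsSubaut d K ∧ K ⊆ B ∧ ∀ C, C ⊆ B → IsSubaut d C → K ⊆ C

/-- The subautomata `S` and `T` (with the common transition function `d`) are isomorphic. -/
def AutIsoOn (d : A → X → A) (S T : Set A) : Prop :=
  ∃ f : A → A, Set.BijOn f S T ∧ ∀ a ∈ S, ∀ x, f (d a x) = d (f a) x

/-- `c` is a trap of the automaton with transition function `d`. -/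
def IsTrapT (d : A → X → A) (c : A) : Prop := ∀ x, d c x = c

/-- The automaton with transition function `d` is strongly connected. -/
def StronglyConnT (d : A → X → A) : Prop :=
  ∀ a b : A, ∃ p : List X, p ≠ [] ∧ DeltaStar d a p = b

/-- The automaton with transition function `d` is strongly trap connected. -/
def StronglyTrapConnT (d : A → X → A) : Prop :=
  ∃ a₀ : A, IsTrapT d a₀ ∧ (∀ c, IsTrapT d c → c = a₀) ∧
    ∀ a, a ≠ a₀ → ∀ b, ∃ p : List X, p ≠ [] ∧ DeltaStar d a p = b

/-- `R(a)`: the subautomaton generated by `a`. -/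
def Rset (d : A → X → A) (a : A) : Set A := {b | ∃ p : List X, DeltaStar d a p = b}

lemma Rset_closed (d : A → X → A) (a : A) {b : A} (hb : b ∈ Rset d a) (x : X) :
    d b x ∈ Rset d a := by
  obtain ⟨p, hp⟩ := hb
  refine ⟨p ++ [x], ?_⟩
  simp only [DeltaStar, List.foldl_append, List.foldl_cons, List.foldl_nil]
  rw [show List.foldl d a p = b from hp]

lemma Rset_mono (d : A → X → A) {a b : A} (h : b ∈ Rset d a) : Rset d b ⊆ Rset d a := by
  obtain ⟨q, hq⟩ := h
  rintro c ⟨p, hp⟩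
  refine ⟨q ++ p, ?_⟩
  simp only [DeltaStar, List.foldl_append] at *
  rw [hq, hp]

/-- `R_a`: the set of states generating the same subautomaton as `a`. -/
def Rcls (d : A → X → A) (a : A) : Set A := {b | Rset d b = Rset d a}

/-- `R[a] = R(a) \ R_a`. -/
def Rbr (d : A → X → A) (a : A) : Set A := Rset d a \ Rcls d a

lemma Rbr_closed (d : A → X → A) (a : A) {b : A} (hb : b ∈ Rbr d a) (x : X) :
    d b x ∈ Rbr d a := by
  refine ⟨Rset_closed d a hb.1 x, fun hmem => hb.2 ?_⟩
  have h1 : Rset d b ⊆ Rset d a := Rset_mono d hb.1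
  have hx : d b x ∈ Rset d b := ⟨[x], rfl⟩
  have h2 : Rset d a ⊆ Rset d b := by
    have := Rset_mono d hx
    rw [show Rset d (d b x) = Rset d a from hmem] at this
    exact this
  exact Set.Subset.antisymm h1 h2

/-- The Rees setoid on `R(a)` collapsing the subautomaton `R[a]` to a point. -/
def PFSetoid (d : A → X → A) (a : A) : Setoid ↥(Rset d a) where
  r s t := s = t ∨ (s.1 ∈ Rbr d a ∧ t.1 ∈ Rbr d a)
  iseqv := by
    refine ⟨fun s => Or.inl rfl, ?_, ?_⟩
    · rintro s t (rfl | ⟨h1, h2⟩)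
      · exact Or.inl rfl
      · exact Or.inr ⟨h2, h1⟩
    · rintro s t u (rfl | ⟨h1, h2⟩) (rfl | ⟨h3, h4⟩)
      · exact Or.inl rfl
      · exact Or.inr ⟨h3, h4⟩
      · exact Or.inr ⟨h1, h2⟩
      · exact Or.inr ⟨h1, h4⟩

/-- The state set of the principal factor `R{a} = R(a)/ρ_{R[a]}`. -/
def PFC (d : A → X → A) (a : A) : Type _ := Quotient (PFSetoid d a)

/-- The transition function of the principal factor `R{a}`. -/
def pfd (d : A → X → A) (a : A) : PFC d a → X → PFC d a := fun q x =>
  Quotient.liftOn q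
    (fun s => (Quotient.mk (PFSetoid d a) ⟨d s.1 x, Rset_closed d a s.2 x⟩ : PFC d a))
    (fun s t hst => Quotient.sound (by
      rcases hst with h | ⟨h1, h2⟩
      · exact Or.inl (by rw [h])
      · exact Or.inr ⟨Rbr_closed d a h1 x, Rbr_closed d a h2 x⟩))

/-- The automaton with transition function `d` is semi-connected: each of its
principal factors is strongly connected or strongly trap connected. -/
def SemiConnT (d : A → X → A) : Prop :=
  ∀ a : A, StronglyConnT (pfd d a) ∨ StronglyTrapConnT (pfd d a)

/-- The restriction of the transition function to a subautomaton. -/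
def restrictMap (d : A → X → A) (B : Set A) (h : ∀ b ∈ B, ∀ x, d b x ∈ B) : B → X → B :=
  fun b x => ⟨d b.1 x, h b.1 b.2 x⟩

open Classical in
/-- `A⁰`: the state set with the trap removed, in case the automaton is non-trivial
and has a unique trap; the whole state set otherwise. -/
noncomputable def ZeroPart (d : A → X → A) : Set A :=
  if Nontrivial A ∧ (∃! c : A, IsTrapT d c) then {c | ¬ IsTrapT d c} else Set.univ

/-- If the congruence generated by `ReesRel B` and a congruence `β` relates `b ∈ B` to `a`,
then `a` is `β`-related to an element of `B`. -/
lemma exists_mem_of_transGen_reesRel {B : Set A} {β : A → A → Prop} (hβ : Equivalence β)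
    {b a : A} (hb : b ∈ B)
    (h : Relation.TransGen (fun u v => ReesRel B u v ∨ β u v) b a) : ∃ c ∈ B, β a c := by
  have step : ∀ u v, ReesRel B u v ∨ β u v → (∃ c ∈ B, β u c) → ∃ c ∈ B, β v c := by
    rintro u v ((rfl | ⟨-, hv⟩) | huv) ⟨c, hc, huc⟩
    · exact ⟨c, hc, huc⟩
    · exact ⟨v, hv, hβ.refl v⟩
    · exact ⟨c, hc, hβ.trans (hβ.symm huv) huc⟩
  induction h with
  | single h => exact step _ _ h ⟨b, hb, hβ.refl b⟩
  | tail _ h ih => exact step _ _ h ih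

/-- For a state-finite automaton `(A, X, δ)` and a subautomaton `B`,
the Rees congruence `ρ_B` has a complement in the lattice of all congruences of `A`
if and only if `B` is a retract subautomaton of `A`. -/
theorem rees_complement_iff_retract [Finite A] [Nonempty A] [Nonempty X]
    (δ : A → X → A) (B : Set A) (hB : IsSubaut δ B) :
    (∃ β : A → A → Prop, IsCong δ β ∧
        (∀ a b, ReesRel B a b → β a b → a = b) ∧
        (∀ a b : A, Relation.TransGen (fun u v => ReesRel B u v ∨ β u v) a b)) ↔
      (∃ f : A → A, IsRetractHomOn δ Set.univ B f) := by
  constructor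
  · rintro ⟨β, ⟨hβ, hδ⟩, hmeet, hjoin⟩
    obtain ⟨b, hb⟩ := hB.1
    choose f hfB hf using fun a => exists_mem_of_transGen_reesRel hβ hb (hjoin b a)
    have eq_of_rel : ∀ u ∈ B, ∀ v ∈ B, β u v → u = v :=
      fun u hu v hv => hmeet u v (Or.inr ⟨hu, hv⟩)
    refine ⟨f, fun a _ x => ?_, fun a _ => hfB a, fun c hc => ?_⟩
    · exact eq_of_rel _ (hfB _) _ (hB.2 _ (hfB a) x)
        (hβ.trans (hβ.symm (hf (δ a x))) (hδ _ _ (hf a) x))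
    · exact eq_of_rel _ (hfB c) _ hc (hβ.symm (hf c))
  · rintro ⟨f, hδ, hfB, hfix⟩
    have hff : ∀ a, f (f a) = f a := fun a => hfix _ (hfB a trivial)
    refine ⟨KerRel f, ⟨⟨fun _ => rfl, Eq.symm, Eq.trans⟩, fun a b h x => ?_⟩, ?_, fun a b => ?_⟩
    · change f a = f b at h
      change f (δ a x) = f (δ b x)
      rw [hδ a trivial, hδ b trivial, h]
    · rintro a b (h | ⟨ha, hb⟩) hab
      · exact h
      · rw [← hfix a ha, ← hfix b hb]
        exact hab
    · refine .tail (b := f b) (.tail (b := f a) (.single (Or.inr (hff a).symm)) ?_)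
        (Or.inr (hff b))
      exact Or.inl (Or.inr ⟨hfB a trivial, hfB b trivial⟩)
end

section
/- Let A = (A, X, δ) be a state-finite automaton without outputs, let B be a subautomaton of A, and let λ_B be a retract homomorphism of A onto B. Then the kernel Ker λ_B is a complement of the Rees congruence ρ_B in the lattice L(A) of all congruences of A, i.e., Ker λ_B ∩ ρ_B = Δ_A and the transitive closure of Ker λ_B ∪ ρ_B equals A × A. -/
/-! Basic notions for state-finite automata without outputs, following M. Fuzesdi,
"Boolean-type retractable state-finite automata without outputs". -/

variable {A X : Type*}

/-- For a state-finite automaton `(A, X, δ)`, a subautomaton `B` and a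
retract homomorphism `f` of `A` onto `B`, the kernel of `f` is a complement of the Rees
congruence `ρ_B` in the lattice of all congruences: `Ker f ∩ ρ_B = Δ_A` and the transitive
closure of `Ker f ∪ ρ_B` is `A × A`. -/
theorem ker_retract_is_complement_of_rees [Finite A] [Nonempty A] [Nonempty X]
    (δ : A → X → A) (B : Set A) (hB : IsSubaut δ B)
    (f : A → A) (hf : IsRetractHomOn δ Set.univ B f) :
    (∀ a b : A, KerRel f a b → ReesRel B a b → a = b) ∧
      (∀ a b : A, Relation.TransGen (fun u v => KerRel f u v ∨ ReesRel B u v) a b) := by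
  obtain ⟨-, hmem, hfix⟩ := hf
  refine ⟨?_, fun a b => ?_⟩
  · rintro a b hker (hab | ⟨ha, hb⟩)
    · exact hab
    · rw [← hfix a ha, ← hfix b hb]
      exact hker
  · have hfa := hmem a (Set.mem_univ a)
    have hfb := hmem b (Set.mem_univ b)
    refine .head (b := f a) (Or.inl (hfix _ hfa).symm) ?_
    refine .head (b := f b) (Or.inr (Or.inr ⟨hfa, hfb⟩)) ?_
    exact .single (Or.inl (hfix _ hfb))
end

section
/- For a state-finite automaton A = (A, X, δ) without outputs the following are equivalent: (i) A is retractable; (ii) A is a direct sum of finitely many state-finite retractable automata, each containing a kernel, whose kernels are pairwise isomorphic. -/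
/-! Basic notions for state-finite automata without outputs, following M. Fuzesdi,
"Boolean-type retractable state-finite automata without outputs". -/

variable {A X : Type*}

lemma IsSubaut.inter {d : A → X → A} {B C : Set A} (hB : IsSubaut d B) (hC : IsSubaut d C)
    (h : (B ∩ C).Nonempty) : IsSubaut d (B ∩ C) :=
  ⟨h, fun b hb x => ⟨hB.2 b hb.1 x, hC.2 b hb.2 x⟩⟩

lemma Minimal.eq_of_isSubaut_inter {d : A → X → A} {M N : Set A} (hM : Minimal (IsSubaut d) M)
    (hN : Minimal (IsSubaut d) N) (h : (M ∩ N).Nonempty) : M = N := by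
  have hI := hM.prop.inter hN.prop h
  exact (hM.eq_of_subset hI Set.inter_subset_left).symm.trans
    (hN.eq_of_subset hI Set.inter_subset_right)

/-- Every subautomaton of a state-finite automaton contains a minimal one. -/
lemma IsSubaut.exists_minimal_subset [Finite A] {d : A → X → A} {B : Set A} (hB : IsSubaut d B) :
    ∃ M ⊆ B, Minimal (IsSubaut d) M :=
  exists_minimal_le_of_wellFoundedLT (IsSubaut d) B hB

/-- A homomorphism into a minimal subautomaton is surjective. -/
lemma Minimal.image_eq_of_hom {d : A → X → A} {M N : Set A} (hN : Minimal (IsSubaut d) N)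
    (hM : IsSubaut d M) {f : A → A} (hf : ∀ a ∈ M, ∀ x, f (d a x) = d (f a) x)
    (hmap : ∀ a ∈ M, f a ∈ N) : f '' M = N := by
  refine hN.eq_of_subset ⟨hM.1.image f, ?_⟩ (Set.image_subset_iff.2 hmap)
  rintro _ ⟨a, ha, rfl⟩ x
  exact ⟨d a x, hM.2 a ha x, hf a ha x⟩

/-- The minimal subautomata of a retractable state-finite automaton are pairwise isomorphic. -/
lemma RetractableOn.autIsoOn_of_minimal [Finite A] {d : A → X → A}
    (h : RetractableOn d Set.univ) {M N : Set A} (hM : Minimal (IsSubaut d) M)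
    (hN : Minimal (IsSubaut d) N) : AutIsoOn d M N := by
  obtain ⟨f, hf, hfN, -⟩ := h N (Set.subset_univ _) hN.prop
  obtain ⟨g, hg, hgM, -⟩ := h M (Set.subset_univ _) hM.prop
  have hfi : f '' M = N :=
    hN.image_eq_of_hom hM.prop (fun a _ => hf a trivial) (fun a _ => hfN a trivial)
  have hgi : g '' N = M :=
    hM.image_eq_of_hom hN.prop (fun a _ => hg a trivial) (fun a _ => hgM a trivial)
  have h₁ : N.ncard ≤ M.ncard := hfi ▸ Set.ncard_image_le M.toFinite
  have h₂ : M.ncard ≤ N.ncard := hgi ▸ Set.ncard_image_le N.toFinite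
  have hinj : Set.InjOn f M :=
    Set.injOn_of_ncard_image_eq (by rw [hfi]; exact le_antisymm h₁ h₂) M.toFinite
  exact ⟨f, hfi ▸ hinj.bijOn_image, fun a _ => hf a trivial⟩

lemma RetractableOn.mono {d : A → X → A} {B C : Set A} (h : RetractableOn d B) (hCB : C ⊆ B) :
    RetractableOn d C := by
  intro D hD hDs
  obtain ⟨f, hf, hfD, hfix⟩ := h D (hD.trans hCB) hDs
  exact ⟨f, fun a ha => hf a (hCB ha), fun a ha => hfD a (hCB ha), hfix⟩

/-- A retractable state-finite automaton is the direct sum of the preimages of its minimal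
subautomata under a retract homomorphism onto their union. -/
lemma RetractableOn.exists_direct_sum [Finite A] [Nonempty A] {d : A → X → A}
    (h : RetractableOn d Set.univ) :
    ∃ (n : ℕ) (P K : Fin n → Set A),
      (∀ i, IsSubaut d (P i)) ∧
      (∀ i j, i ≠ j → Disjoint (P i) (P j)) ∧
      (⋃ i, P i) = Set.univ ∧
      (∀ i, RetractableOn d (P i)) ∧
      (∀ i, IsKernelOf d (P i) (K i)) ∧
      (∀ i j, AutIsoOn d (K i) (K j)) := by
  obtain ⟨n, ⟨e⟩⟩ := Finite.exists_equiv_fin {M : Set A // Minimal (IsSubaut d) M}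
  set K : Fin n → Set A := fun i => (e.symm i).1
  have hK (i) : Minimal (IsSubaut d) (K i) := (e.symm i).2
  have hKsurj {M} (hM : Minimal (IsSubaut d) M) : ∃ i, K i = M := ⟨e ⟨M, hM⟩, by simp [K]⟩
  have hKinj {i j} {a : A} (hi : a ∈ K i) (hj : a ∈ K j) : i = j :=
    e.symm.injective (Subtype.ext ((hK i).eq_of_isSubaut_inter (hK j) ⟨a, hi, hj⟩))
  have hU : IsSubaut d (⋃ i, K i) := by
    constructor
    · obtain ⟨M, -, hM⟩ := IsSubaut.exists_minimal_subset (d := d) (B := Set.univ)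
        ⟨Set.univ_nonempty, fun _ _ _ => trivial⟩
      obtain ⟨i, rfl⟩ := hKsurj hM
      exact hM.prop.1.mono (Set.subset_iUnion K i)
    · intro b hb x
      obtain ⟨i, hi⟩ := Set.mem_iUnion.1 hb
      exact Set.mem_iUnion.2 ⟨i, (hK i).prop.2 b hi x⟩
  obtain ⟨r, hr, hrU, hfix⟩ := h _ (Set.subset_univ _) hU
  have hrK {i a} (ha : a ∈ K i) : r a = a := hfix a (Set.mem_iUnion.2 ⟨i, ha⟩)
  have hKP (i) : K i ⊆ r ⁻¹' K i := fun a ha => by rwa [Set.mem_preimage, hrK ha]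
  refine ⟨n, fun i => r ⁻¹' K i, K, fun i => ⟨(hK i).prop.1.mono (hKP i), ?_⟩, ?_, ?_,
    fun i => h.mono (Set.subset_univ _), fun i => ⟨(hK i).prop, hKP i, ?_⟩,
    fun i j => h.autIsoOn_of_minimal (hK i) (hK j)⟩
  · intro b hb x
    rw [Set.mem_preimage, hr b trivial x]
    exact (hK i).prop.2 _ hb x
  · exact fun i j hij => Set.disjoint_left.2 fun a hi hj => hij (hKinj hi hj)
  · exact Set.eq_univ_of_forall fun a => by simpa using hrU a trivial
  · intro C hC hCs
    obtain ⟨M, hMC, hM⟩ := hCs.exists_minimal_subset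
    obtain ⟨j, rfl⟩ := hKsurj hM
    obtain ⟨a, ha⟩ := hM.prop.1
    have hai : r a ∈ K i := hC (hMC ha)
    rw [hrK ha] at hai
    rwa [hKinj hai ha]

/-- A direct sum of retractable automata with pairwise isomorphic kernels is retractable. -/
lemma retractableOn_univ_of_direct_sum {d : A → X → A} {ι : Type*} {P K : ι → Set A}
    (hP : ∀ i, IsSubaut d (P i)) (hdisj : ∀ i j, i ≠ j → Disjoint (P i) (P j))
    (hcover : (⋃ i, P i) = Set.univ) (hret : ∀ i, RetractableOn d (P i))
    (hK : ∀ i, IsKernelOf d (P i) (K i)) (hiso : ∀ i j, AutIsoOn d (K i) (K j)) :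
    RetractableOn d Set.univ := by
  intro C _ hC
  have hex (a : A) : ∃ i, a ∈ P i := Set.mem_iUnion.1 (hcover ▸ Set.mem_univ a)
  choose p hp using hex
  have hpu {a i} (h : a ∈ P i) : p a = i := by
    by_contra hne
    exact Set.disjoint_left.1 (hdisj _ _ hne) (hp a) h
  have hpx (a : A) (x : X) : p (d a x) = p a := hpu ((hP _).2 a (hp a) x)
  obtain ⟨c, hc⟩ := hC.1
  have key (i) : ∃ f : A → A, (∀ a ∈ P i, ∀ x, f (d a x) = d (f a) x) ∧
      (∀ a ∈ P i, f a ∈ C) ∧ ∀ a ∈ C ∩ P i, f a = a := by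
    by_cases hne : (C ∩ P i).Nonempty
    · obtain ⟨f, hf, hfC, hfix⟩ := hret i _ Set.inter_subset_right (hC.inter (hP i) hne)
      exact ⟨f, hf, fun a ha => (hfC a ha).1, hfix⟩
    · obtain ⟨f, hf, hfK, -⟩ := hret i (K i) (hK i).2.1 (hK i).1
      obtain ⟨g, hg, hgd⟩ := hiso i (p c)
      have hKC : K (p c) ⊆ C ∩ P (p c) :=
        (hK (p c)).2.2 _ Set.inter_subset_right (hC.inter (hP _) ⟨c, hc, hp c⟩)
      exact ⟨g ∘ f, fun a ha x => by simp [hf a ha x, hgd _ (hfK a ha) x],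
        fun a ha => (hKC (hg.mapsTo (hfK a ha))).1, fun a ha => absurd ⟨a, ha⟩ hne⟩
  choose F hF hFC hFfix using key
  refine ⟨fun a => F (p a) a, fun a _ x => ?_, fun a _ => hFC _ a (hp a),
    fun a ha => hFfix _ a ⟨ha, hp a⟩⟩
  simp only [hpx]
  exact hF _ a (hp a) x

/-- A state-finite automaton is retractable iff it is a direct sum of
finitely many state-finite retractable automata, each containing a kernel, whose kernels
are pairwise isomorphic. -/
theorem retractable_iff_direct_sum [Finite A] [Nonempty A] [Nonempty X] (δ : A → X → A) :
    RetractableOn δ Set.univ ↔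
      ∃ (n : ℕ) (P K : Fin n → Set A),
        (∀ i, IsSubaut δ (P i)) ∧
        (∀ i j, i ≠ j → Disjoint (P i) (P j)) ∧
        (⋃ i, P i) = Set.univ ∧
        (∀ i, RetractableOn δ (P i)) ∧
        (∀ i, IsKernelOf δ (P i) (K i)) ∧
        (∀ i j, AutIsoOn δ (K i) (K j)) := by
  constructor
  · exact fun h => h.exists_direct_sum
  · rintro ⟨n, P, K, hP, hdisj, hcover, hret, hK, hiso⟩
    exact retractableOn_univ_of_direct_sum hP hdisj hcover hret hK hiso
end

section
/- Let the state-finite automaton A = (A, X, δ) without outputs be a direct sum of finitely many Boolean-type retractable automata A_1, …, A_n, where each A_i contains a kernel T_i and the kernels T_1, …, T_n are pairwise isomorphic as automata. Then A is a Boolean-type retractable automaton. -/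
/-! Basic notions for state-finite automata without outputs, following M. Fuzesdi,
"Boolean-type retractable state-finite automata without outputs". -/

variable {A X : Type*}

/-- An isomorphism of subautomata has an inverse which is again a homomorphism. -/
lemma AutIsoOn.exists_inverse {d : A → X → A} {S T : Set A} [Nonempty A]
    (hS : ∀ a ∈ S, ∀ x, d a x ∈ S) (h : AutIsoOn d S T) :
    ∃ f g : A → A, Set.MapsTo f S T ∧ Set.MapsTo g T S ∧ Set.LeftInvOn f g T ∧
      Set.LeftInvOn g f S ∧ (∀ a ∈ S, ∀ x, f (d a x) = d (f a) x) ∧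
      ∀ b ∈ T, ∀ x, g (d b x) = d (g b) x := by
  obtain ⟨f, hbij, hf⟩ := h
  have hinv := hbij.invOn_invFunOn
  have hmaps := hbij.surjOn.mapsTo_invFunOn
  refine ⟨f, Function.invFunOn f S, hbij.mapsTo, hmaps, hinv.2, hinv.1, hf, fun b hb x => ?_⟩
  have hgb := hmaps hb
  calc Function.invFunOn f S (d b x)
      = Function.invFunOn f S (d (f (Function.invFunOn f S b)) x) := by rw [hinv.2 hb]
    _ = Function.invFunOn f S (f (d (Function.invFunOn f S b) x)) := by rw [hf _ hgb]
    _ = d (Function.invFunOn f S b) x := hinv.1 (hS _ hgb x)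

/-- In a Boolean-type family, retracting first onto the larger of two nested subautomata
does not change the retraction onto the smaller one. -/
lemma retract_comp_of_ker_le {d : A → X → A} {B : Set A} {Λ : Set A → A → A}
    (hΛ : ∀ C, C ⊆ B → IsSubaut d C → IsRetractHomOn d B C (Λ C))
    (hmono : ∀ C₁ C₂, C₁ ⊆ C₂ → C₂ ⊆ B → IsSubaut d C₁ → IsSubaut d C₂ →
      ∀ a ∈ B, ∀ b ∈ B, Λ C₂ a = Λ C₂ b → Λ C₁ a = Λ C₁ b)
    {C₁ C₂ : Set A} (h12 : C₁ ⊆ C₂) (h2 : C₂ ⊆ B) (hC₁ : IsSubaut d C₁)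
    (hC₂ : IsSubaut d C₂) {a : A} (ha : a ∈ B) : Λ C₁ (Λ C₂ a) = Λ C₁ a := by
  obtain ⟨-, hmem, hfix⟩ := hΛ C₂ h2 hC₂
  exact hmono C₁ C₂ h12 h2 hC₁ hC₂ _ (h2 (hmem a ha)) a ha (hfix _ (hmem a ha))

/-- To a set meeting some member of a cover indexed by `Fin n`, assign the least index
of a member it meets. -/
lemma exists_least_index {n : ℕ} {P : Fin n → Set A} [Nonempty A]
    (hcover : (⋃ i, P i) = Set.univ) :
    ∃ j : Set A → Fin n, ∀ C : Set A, C.Nonempty →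
      (C ∩ P (j C)).Nonempty ∧ ∀ i, (C ∩ P i).Nonempty → j C ≤ i := by
  have hex : ∀ a, ∃ i, a ∈ P i := fun a => by
    simpa using (hcover.symm ▸ Set.mem_univ a : a ∈ ⋃ i, P i)
  obtain ⟨i₀, -⟩ := hex (Classical.arbitrary A)
  have key : ∀ C : Set A, ∃ j : Fin n, C.Nonempty →
      (C ∩ P j).Nonempty ∧ ∀ i, (C ∩ P i).Nonempty → j ≤ i := by
    intro C
    by_cases hC : C.Nonempty
    · obtain ⟨c, hc⟩ := hC
      obtain ⟨i, hi⟩ := hex c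
      obtain ⟨m, hm, hmin⟩ :=
        (wellFounded_lt (α := Fin n)).has_min {i | (C ∩ P i).Nonempty} ⟨i, c, hc, hi⟩
      exact ⟨m, fun _ => ⟨hm, fun k hk => not_lt.mp (hmin k hk)⟩⟩
    · exact ⟨i₀, fun h => absurd h hC⟩
  choose j hj using key
  exact ⟨j, hj⟩

/-- If a state-finite automaton `A` is a direct sum of finitely many
Boolean-type retractable automata, each containing a kernel, with pairwise isomorphic
kernels, then `A` is a Boolean-type retractable automaton. -/
theorem booleanType_of_direct_sum [Finite A] [Nonempty A] [Nonempty X] (δ : A → X → A)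
    (n : ℕ) (P K : Fin n → Set A)
    (hsub : ∀ i, IsSubaut δ (P i))
    (hdisj : ∀ i j, i ≠ j → Disjoint (P i) (P j))
    (hcover : (⋃ i, P i) = Set.univ)
    (hbool : ∀ i, BooleanTypeOn δ (P i))
    (hker : ∀ i, IsKernelOf δ (P i) (K i))
    (hiso : ∀ i j, AutIsoOn δ (K i) (K j)) :
    BooleanTypeOn δ Set.univ := by
  classical
  have hex : ∀ a, ∃ i, a ∈ P i := fun a => by
    simpa using (hcover.symm ▸ Set.mem_univ a : a ∈ ⋃ i, P i)
  choose idx hidx using hex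
  have idx_eq : ∀ {a i}, a ∈ P i → idx a = i := fun {a i} h => by
    by_contra hne
    exact Set.disjoint_left.mp (hdisj _ _ hne) (hidx a) h
  have idx_step : ∀ a x, idx (δ a x) = idx a := fun a x =>
    idx_eq ((hsub _).2 a (hidx a) x)
  obtain ⟨j, hj⟩ := exists_least_index hcover
  choose Λ hΛ hmono using fun i => (hbool i).2
  let i₀ := idx (Classical.arbitrary A)
  choose f g hfm hgm hfg hgf hf hg using
    fun i => (hiso i i₀).exists_inverse (hker i).1.2
  have hK := fun i => hΛ i (K i) (hker i).2.1 (hker i).1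
  -- the common projection of all summands onto the kernel of the summand `i₀`
  let τ : A → A := fun a => f (idx a) (Λ (idx a) (K (idx a)) a)
  have τ_mem : ∀ a, τ a ∈ K i₀ := fun a => hfm _ ((hK _).2.1 a (hidx a))
  have τ_step : ∀ a x, τ (δ a x) = δ (τ a) x := fun a x => by
    simp only [τ, idx_step]
    rw [(hK _).1 a (hidx a), hf _ _ ((hK _).2.1 a (hidx a))]
  have τ_of_mem : ∀ {i a}, a ∈ K i → τ a = f i a := fun {i a} h => by
    simp only [τ, idx_eq ((hker i).2.1 h), (hK i).2.2 a h]
  let L : Set A → A → A := fun C a =>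
    if (C ∩ P (idx a)).Nonempty then Λ (idx a) (C ∩ P (idx a)) a else g (j C) (τ a)
  have L_pos : ∀ {C i a}, (C ∩ P i).Nonempty → a ∈ P i → L C a = Λ i (C ∩ P i) a := by
    intro C i a hi ha
    obtain rfl := idx_eq ha
    exact if_pos hi
  have L_neg : ∀ {C i a}, ¬ (C ∩ P i).Nonempty → a ∈ P i → L C a = g (j C) (τ a) := by
    intro C i a hi ha
    obtain rfl := idx_eq ha
    exact if_neg hi
  have hsubI : ∀ {C i}, IsSubaut δ C → (C ∩ P i).Nonempty → IsSubaut δ (C ∩ P i) :=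
    fun hC hi => hC.inter (hsub _) hi
  have hKC : ∀ {C i}, IsSubaut δ C → (C ∩ P i).Nonempty → K i ⊆ C ∩ P i :=
    fun {C i} hC hi => (hker i).2.2 _ Set.inter_subset_right (hsubI hC hi)
  have hR : ∀ {C i}, IsSubaut δ C → (C ∩ P i).Nonempty →
      IsRetractHomOn δ (P i) (C ∩ P i) (Λ i (C ∩ P i)) :=
    fun hC hi => hΛ _ _ Set.inter_subset_right (hsubI hC hi)
  have hL : ∀ C, C ⊆ Set.univ → IsSubaut δ C → IsRetractHomOn δ Set.univ C (L C) := by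
    intro C _ hC
    refine ⟨fun a _ x => ?_, fun a _ => ?_, fun c hc => ?_⟩
    · have hax := (hsub _).2 a (hidx a) x
      by_cases h : (C ∩ P (idx a)).Nonempty
      · rw [L_pos h hax, L_pos h (hidx a), (hR hC h).1 a (hidx a)]
      · rw [L_neg h hax, L_neg h (hidx a), τ_step, hg _ _ (τ_mem a)]
    · by_cases h : (C ∩ P (idx a)).Nonempty
      · rw [L_pos h (hidx a)]
        exact ((hR hC h).2.1 a (hidx a)).1
      · rw [L_neg h (hidx a)]
        exact (hKC hC (hj C hC.1).1 (hgm _ (τ_mem a))).1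
    · have h : (C ∩ P (idx c)).Nonempty := ⟨c, hc, hidx c⟩
      rw [L_pos h (hidx c)]
      exact (hR hC h).2.2 c ⟨hc, hidx c⟩
  have τ_L : ∀ {C}, IsSubaut δ C → ∀ a, τ (L C a) = τ a := by
    intro C hC a
    by_cases h : (C ∩ P (idx a)).Nonempty
    · rw [L_pos h (hidx a)]
      simp only [τ, idx_eq ((hR hC h).2.1 a (hidx a)).2]
      rw [retract_comp_of_ker_le (hΛ _) (hmono _) (hKC hC h) Set.inter_subset_right
        (hker _).1 (hsubI hC h) (hidx a)]
    · rw [L_neg h (hidx a), τ_of_mem (hgm _ (τ_mem a)), hfg _ (τ_mem a)]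
  -- states of different summands identified by `L C₂`, the first summand meeting `C₁`
  have cross : ∀ {C₁ C₂}, C₁ ⊆ C₂ → IsSubaut δ C₁ → IsSubaut δ C₂ → ∀ a b,
      idx a ≠ idx b → (C₁ ∩ P (idx a)).Nonempty → L C₂ a = L C₂ b → L C₁ a = L C₁ b := by
    intro C₁ C₂ h12 hC₁ hC₂ a b hne h1 hab
    have h2 : (C₂ ∩ P (idx a)).Nonempty := h1.mono (Set.inter_subset_inter_left _ h12)
    have hLa : L C₂ a ∈ P (idx a) := by
      rw [L_pos h2 (hidx a)]
      exact ((hR hC₂ h2).2.1 a (hidx a)).2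
    have hb2 : ¬ (C₂ ∩ P (idx b)).Nonempty := fun h => by
      have hLb : L C₂ b ∈ P (idx b) := by
        rw [L_pos h (hidx b)]
        exact ((hR hC₂ h).2.1 b (hidx b)).2
      exact hne ((idx_eq hLa).symm.trans (hab ▸ idx_eq hLb))
    have hb1 : ¬ (C₁ ∩ P (idx b)).Nonempty := fun h =>
      hb2 (h.mono (Set.inter_subset_inter_left _ h12))
    have hLb := L_neg hb2 (hidx b)
    have hj2 : j C₂ = idx a := by
      rw [← idx_eq hLa, hab, hLb]
      exact (idx_eq ((hker _).2.1 (hgm _ (τ_mem b)))).symm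
    have hj1 : j C₁ = j C₂ := le_antisymm ((hj C₁ hC₁.1).2 _ (hj2 ▸ h1))
      ((hj C₂ hC₂.1).2 _ ((hj C₁ hC₁.1).1.mono (Set.inter_subset_inter_left _ h12)))
    have hgK : g (idx a) (τ b) ∈ C₁ ∩ P (idx a) := hKC hC₁ h1 (hgm _ (τ_mem b))
    have hLa' : Λ (idx a) (C₂ ∩ P (idx a)) a = g (idx a) (τ b) := by
      rw [← L_pos h2 (hidx a), hab, hLb, hj2]
    rw [L_neg hb1 (hidx b), hj1, hj2, L_pos h1 (hidx a),
      ← retract_comp_of_ker_le (hΛ _) (hmono _) (Set.inter_subset_inter_left _ h12)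
        Set.inter_subset_right (hsubI hC₁ h1) (hsubI hC₂ h2) (hidx a), hLa']
    exact (hR hC₁ h1).2.2 _ hgK
  refine ⟨fun C hC hCs => ⟨L C, hL C hC hCs⟩, L, hL, ?_⟩
  intro C₁ C₂ h12 _ hC₁ hC₂ a _ b _ hab
  have hτ : τ a = τ b := by rw [← τ_L hC₂ a, hab, τ_L hC₂ b]
  by_cases hi : idx a = idx b
  · have hb : b ∈ P (idx a) := hi ▸ hidx b
    by_cases h : (C₁ ∩ P (idx a)).Nonempty
    · have h2 := h.mono (Set.inter_subset_inter_left _ h12)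
      rw [L_pos h2 (hidx a), L_pos h2 hb] at hab
      rw [L_pos h (hidx a), L_pos h hb]
      exact hmono _ _ _ (Set.inter_subset_inter_left _ h12) Set.inter_subset_right
        (hsubI hC₁ h) (hsubI hC₂ h2) _ (hidx a) _ hb hab
    · rw [L_neg h (hidx a), L_neg h hb, hτ]
  · by_cases ha : (C₁ ∩ P (idx a)).Nonempty
    · exact cross h12 hC₁ hC₂ a b hi ha hab
    · by_cases hb : (C₁ ∩ P (idx b)).Nonempty
      · exact (cross h12 hC₁ hC₂ b a (Ne.symm hi) hb hab.symm).symm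
      · rw [L_neg ha (hidx a), L_neg hb (hidx b), hτ]
end

section
/- If the automaton A = (A, X, δ) without outputs is a dilation of a subautomaton B = (B, X, δ_B) and B is a Boolean-type retractable automaton, then A is a Boolean-type retractable automaton. -/
/-! Basic notions for state-finite automata without outputs, following M. Fuzesdi,
"Boolean-type retractable state-finite automata without outputs". -/

variable {A X : Type*}

lemma IsSubaut.inter_of_dilation [Nonempty X] {δ : A → X → A} {B C : Set A}
    (hB : IsSubaut δ B) (hC : IsSubaut δ C) {φ : A → A} (hmaps : ∀ a, φ a ∈ B)
    (hdil : ∀ a x, δ a x = δ (φ a) x) : IsSubaut δ (C ∩ B) := by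
  refine ⟨?_, fun b hb x => ⟨hC.2 b hb.1 x, hB.2 b hb.2 x⟩⟩
  obtain ⟨c, hc⟩ := hC.1
  obtain ⟨x⟩ := ‹Nonempty X›
  exact ⟨δ c x, hC.2 c hc x, hdil c x ▸ hB.2 _ (hmaps c) x⟩

open Classical in
/-- Extend a retract homomorphism `g` of `B` onto `C ∩ B` to the dilation `A` of `B` given
by `φ`: the elements of `C` are fixed, and the others are first sent to `B` by `φ`. -/
noncomputable def dilationRetract (φ : A → A) (C : Set A) (g : A → A) : A → A :=
  fun a => if a ∈ C then a else g (φ a)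

lemma dilationRetract_of_mem {φ : A → A} {C : Set A} (g : A → A) {a : A} (ha : a ∈ C) :
    dilationRetract φ C g a = a := if_pos ha

lemma dilationRetract_of_notMem {φ : A → A} {C : Set A} (g : A → A) {a : A} (ha : a ∉ C) :
    dilationRetract φ C g a = g (φ a) := if_neg ha

lemma dilationRetract_of_mem_base {φ : A → A} {B C : Set A} {g : A → A}
    (hfix : ∀ b ∈ B, φ b = b) (hg : ∀ c ∈ C ∩ B, g c = c) {a : A} (ha : a ∈ B) :
    dilationRetract φ C g a = g a := by
  by_cases hC : a ∈ C
  · rw [dilationRetract_of_mem g hC, hg a ⟨hC, ha⟩]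
  · rw [dilationRetract_of_notMem g hC, hfix a ha]

lemma isRetractHomOn_dilationRetract {δ : A → X → A} {B C : Set A}
    (hB : IsSubaut δ B) (hC : IsSubaut δ C) {φ : A → A} (hmaps : ∀ a, φ a ∈ B)
    (hfix : ∀ b ∈ B, φ b = b) (hdil : ∀ a x, δ a x = δ (φ a) x) {g : A → A}
    (hg : IsRetractHomOn δ B (C ∩ B) g) :
    IsRetractHomOn δ Set.univ C (dilationRetract φ C g) := by
  obtain ⟨hhom, hinto, hid⟩ := hg
  refine ⟨fun a _ x => ?_, fun a _ => ?_, fun c hc => dilationRetract_of_mem g hc⟩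
  · by_cases ha : a ∈ C
    · rw [dilationRetract_of_mem g ha, dilationRetract_of_mem g (hC.2 a ha x)]
    · rw [dilationRetract_of_notMem g ha, hdil a x,
        dilationRetract_of_mem_base hfix hid (hB.2 _ (hmaps a) x), hhom _ (hmaps a)]
  · by_cases ha : a ∈ C
    · rwa [dilationRetract_of_mem g ha]
    · rw [dilationRetract_of_notMem g ha]
      exact (hinto _ (hmaps a)).1

lemma dilationRetract_eq_of_eq {B C₁ C₂ : Set A} (hC : C₁ ⊆ C₂) {φ : A → A}
    (hmaps : ∀ a, φ a ∈ B) (hfix : ∀ b ∈ B, φ b = b) {g₁ g₂ : A → A}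
    (hinto : ∀ a ∈ B, g₂ a ∈ C₂ ∩ B)
    (hid₁ : ∀ c ∈ C₁ ∩ B, g₁ c = c) (hid₂ : ∀ c ∈ C₂ ∩ B, g₂ c = c)
    (hker : ∀ a ∈ B, ∀ b ∈ B, g₂ a = g₂ b → g₁ a = g₁ b) {a b : A}
    (hab : dilationRetract φ C₂ g₂ a = dilationRetract φ C₂ g₂ b) :
    dilationRetract φ C₁ g₁ a = dilationRetract φ C₁ g₁ b := by
  have mixed : ∀ {a b : A}, a ∈ C₂ → b ∉ C₂ → a = g₂ (φ b) →
      dilationRetract φ C₁ g₁ a = dilationRetract φ C₁ g₁ b := by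
    intro a b ha hb h
    have haB : a ∈ B := h ▸ (hinto _ (hmaps b)).2
    rw [dilationRetract_of_mem_base hfix hid₁ haB,
      dilationRetract_of_notMem g₁ (fun hb₁ => hb (hC hb₁))]
    exact hker a haB _ (hmaps b) ((hid₂ a ⟨ha, haB⟩).trans h)
  by_cases ha : a ∈ C₂ <;> by_cases hb : b ∈ C₂
  · rw [dilationRetract_of_mem g₂ ha, dilationRetract_of_mem g₂ hb] at hab
    rw [hab]
  · rw [dilationRetract_of_mem g₂ ha, dilationRetract_of_notMem g₂ hb] at hab
    exact mixed ha hb hab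
  · rw [dilationRetract_of_notMem g₂ ha, dilationRetract_of_mem g₂ hb] at hab
    exact (mixed hb ha hab.symm).symm
  · rw [dilationRetract_of_notMem g₂ ha, dilationRetract_of_notMem g₂ hb] at hab
    rw [dilationRetract_of_notMem g₁ (fun h => ha (hC h)),
      dilationRetract_of_notMem g₁ (fun h => hb (hC h))]
    exact hker _ (hmaps a) _ (hmaps b) hab

/-- If the automaton `A` is a dilation of a subautomaton `B` and `B` is
a Boolean-type retractable automaton, then `A` is a Boolean-type retractable automaton. -/
theorem booleanType_of_dilation [Nonempty A] [Nonempty X]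
    (δ : A → X → A) (B : Set A) (hB : IsSubaut δ B)
    (φ : A → A) (hmaps : ∀ a, φ a ∈ B) (hfix : ∀ b ∈ B, φ b = b)
    (hdil : ∀ a x, δ a x = δ (φ a) x)
    (hbool : BooleanTypeOn δ B) :
    BooleanTypeOn δ Set.univ := by
  obtain ⟨-, Λ, hΛ, hker⟩ := hbool
  have hsub : ∀ C, IsSubaut δ C → IsSubaut δ (C ∩ B) := fun C hC =>
    hB.inter_of_dilation hC hmaps hdil
  have hret : ∀ C, IsSubaut δ C → IsRetractHomOn δ B (C ∩ B) (Λ (C ∩ B)) := fun C hC =>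
    hΛ _ Set.inter_subset_right (hsub C hC)
  have hext : ∀ C, IsSubaut δ C →
      IsRetractHomOn δ Set.univ C (dilationRetract φ C (Λ (C ∩ B))) := fun C hC =>
    isRetractHomOn_dilationRetract hB hC hmaps hfix hdil (hret C hC)
  refine ⟨fun C _ hC => ⟨_, hext C hC⟩, fun C => dilationRetract φ C (Λ (C ∩ B)),
    fun C _ hC => hext C hC, fun C₁ C₂ h₁₂ _ hC₁ hC₂ a _ b _ hab => ?_⟩
  exact dilationRetract_eq_of_eq h₁₂ hmaps hfix (hret C₂ hC₂).2.1 (hret C₁ hC₁).2.2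
    (hret C₂ hC₂).2.2
    (hker _ _ (Set.inter_subset_inter_left B h₁₂) Set.inter_subset_right
      (hsub C₁ hC₁) (hsub C₂ hC₂)) hab
end

section
/- Let (T, ≤) be a finite tree with least element i₀ (a finite partially ordered set with a least element in which the set of elements below any given element is a chain, so that any two elements have a greatest lower bound and any nonempty subset possessing an upper bound has a greatest element). Write i ≻ j when i covers j. Let {A_i = (A_i, X, δ_i) : i ∈ T} be a family of pairwise disjoint state-finite automata such that: (i) A_{i₀} is strongly connected and A_i is strongly trap connected for every i ≠ i₀; for a non-trivial automaton A_i with unique trap a_i set A_i⁰ = A_i ∖ {a_i}, and set A_i⁰ = A_i otherwise (in particular A_{i₀}⁰ = A_{i₀}); (ii) for every covering pair i ≻ j there is a partial homomorphism φ_{i,j} : A_i⁰ → A_j⁰, meaning that whenever a ∈ A_i⁰, x ∈ X and δ_i(a, x) ∈ A_i⁰, then δ_j(φ_{i,j}(a), x) ∈ A_j⁰ and δ_j(φ_{i,j}(a), x) = φ_{i,j}(δ_i(a, x)); (iii) for every covering pair i ≻ j there exist a ∈ A_i⁰ and x ∈ X with δ_i(a, x) ∉ A_i⁰ and δ_j(φ_{i,j}(a),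 x) ∈ A_j⁰. For i ≥ j define Φ_{i,j} : A_i⁰ → A_j⁰ as the composite φ_{k_n, j} ∘ … ∘ φ_{i, k_1} along the (unique) covering chain i ≻ k_1 ≻ … ≻ k_n ≻ j, with Φ_{i,i} the identity. Let A = ⋃_{i ∈ T} A_i⁰ and define δ' : A × X → A by δ'(a, x) = δ_{j*}(Φ_{i,j*}(a), x) for a ∈ A_i⁰, where j* = i'[a,x] is the greatest element of the set {j ∈ T : j ≤ i and δ_j(Φ_{i,j}(a), x) ∈ A_j⁰} (this set is nonempty, containing i₀, and is contained in the chain below i, so j* exists). Then the automaton (A, X, δ') is a semi-connected Boolean-type retractable automaton containing a kernel. -/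
/-! Basic notions for state-finite automata without outputs, following M. Fuzesdi,
"Boolean-type retractable state-finite automata without outputs". -/

variable {A X : Type*}

lemma DeltaStar_append (d : A → X → A) (a : A) (p q : List X) :
    DeltaStar d a (p ++ q) = DeltaStar d (DeltaStar d a p) q :=
  List.foldl_append

lemma self_mem_Rset (d : A → X → A) (a : A) : a ∈ Rset d a := ⟨[], rfl⟩

lemma IsSubaut.Rset_subset {d : A → X → A} {C : Set A} (hC : IsSubaut d C) {a : A}
    (ha : a ∈ C) : Rset d a ⊆ C := by
  rintro b ⟨p, rfl⟩
  induction p generalizing a with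
  | nil => exact ha
  | cons x p ih => exact ih (hC.2 a ha x)

lemma IsTrapT.DeltaStar_eq {d : A → X → A} {c : A} (hc : IsTrapT d c) (p : List X) :
    DeltaStar d c p = c := by
  induction p with
  | nil => rfl
  | cons x p ih =>
    change DeltaStar d (d c x) p = c
    rw [hc x, ih]

lemma isTrapT_of_notMem_ZeroPart {d : A → X → A} {c : A} (hc : c ∉ ZeroPart d) :
    IsTrapT d c := by
  by_contra h
  unfold ZeroPart at hc
  split_ifs at hc
  · exact hc h
  · exact hc trivial

lemma not_isTrapT_of_mem_ZeroPart {d : A → X → A} {a c : A} (hc : c ∉ ZeroPart d)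
    (ha : a ∈ ZeroPart d) : ¬ IsTrapT d a := by
  unfold ZeroPart at hc ha
  split_ifs at hc ha
  · exact ha
  · exact absurd trivial hc

lemma StronglyConnT.mem_ZeroPart {d : A → X → A} (hd : StronglyConnT d) (a : A) :
    a ∈ ZeroPart d := by
  by_contra ha
  have hsub : ∀ b, b = a := fun b => by
    obtain ⟨p, -, hp⟩ := hd a b
    rw [← hp, (isTrapT_of_notMem_ZeroPart ha).DeltaStar_eq]
  unfold ZeroPart at ha
  split_ifs at ha with h
  · have := h.1
    obtain ⟨b, hb⟩ := exists_ne a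
    exact hb (hsub b)
  · exact ha trivial

/-- If `ZeroPart d` is a proper subset, strong trap connectedness connects any two of its states. -/
lemma StronglyTrapConnT.exists_word {d : A → X → A} (hd : StronglyTrapConnT d) {a c : A}
    (hc : c ∉ ZeroPart d) (ha : a ∈ ZeroPart d) (b : A) :
    ∃ p : List X, p ≠ [] ∧ DeltaStar d a p = b := by
  obtain ⟨a₀, h₀, -, h⟩ := hd
  refine h a ?_ b
  rintro rfl
  exact not_isTrapT_of_mem_ZeroPart hc ha h₀

lemma pfd_DeltaStar (d : A → X → A) (a : A) (s t : Rset d a) (p : List X)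
    (h : DeltaStar d s.1 p = t.1) :
    DeltaStar (pfd d a) (Quotient.mk (PFSetoid d a) s : PFC d a) p =
      Quotient.mk (PFSetoid d a) t := by
  induction p generalizing s with
  | nil =>
    have : s = t := Subtype.ext h
    subst this
    rfl
  | cons x p ih => exact ih ⟨d s.1 x, Rset_closed d a s.2 x⟩ h

/-- An automaton in which every state is reachable from itself by a nonempty word is
semi-connected. -/
lemma semiConnT_of_loops (d : A → X → A)
    (h : ∀ a : A, ∃ p : List X, p ≠ [] ∧ DeltaStar d a p = a) : SemiConnT d := by
  intro a
  have reach : ∀ s t : Rset d a, s.1 ∉ Rbr d a → ∃ p : List X, p ≠ [] ∧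
      DeltaStar (pfd d a) (Quotient.mk (PFSetoid d a) s : PFC d a) p =
        Quotient.mk (PFSetoid d a) t := by
    intro s t hs
    have hsa : Rset d s.1 = Rset d a := by
      by_contra hne
      exact hs ⟨s.2, hne⟩
    obtain ⟨q, hq⟩ : t.1 ∈ Rset d s.1 := hsa.symm.subset t.2
    obtain ⟨p, hp, hps⟩ := h s.1
    refine ⟨p ++ q, by simp [hp], pfd_DeltaStar d a s t _ ?_⟩
    rw [DeltaStar_append, hps, hq]
  by_cases hne : (Rbr d a).Nonempty
  · right
    obtain ⟨e, he⟩ := hne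
    have reach' : ∀ u : PFC d a, u ≠ Quotient.mk (PFSetoid d a) ⟨e, he.1⟩ → ∀ v : PFC d a,
        ∃ p : List X, p ≠ [] ∧ DeltaStar (pfd d a) u p = v := by
      intro u hu v
      induction u using Quotient.inductionOn with | _ s =>
      induction v using Quotient.inductionOn with | _ t =>
      exact reach s t fun hs => hu (Quotient.sound (Or.inr ⟨hs, he⟩))
    refine ⟨Quotient.mk (PFSetoid d a) ⟨e, he.1⟩, fun x => ?_, fun c hc => ?_, reach'⟩
    · exact Quotient.sound (Or.inr ⟨Rbr_closed d a he x, he⟩)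
    · by_contra hne
      obtain ⟨p, -, hp⟩ := reach' c hne (Quotient.mk (PFSetoid d a) ⟨e, he.1⟩)
      exact hne (by rw [← hp, hc.DeltaStar_eq])
  · left
    intro u v
    induction u using Quotient.inductionOn with | _ s =>
    induction v using Quotient.inductionOn with | _ t =>
    exact reach s t fun hs => hne ⟨_, hs⟩

lemma exists_le_covBy_of_lt_of_finite {T : Type*} [PartialOrder T] [Finite T] {k i : T}
    (h : k < i) : ∃ j, k ≤ j ∧ j ⋖ i := by
  obtain ⟨j, hj⟩ := (Set.toFinite {j | k ≤ j ∧ j < i}).exists_maximal ⟨k, le_rfl, h⟩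
  refine ⟨j, hj.prop.1, hj.prop.2, fun c hjc hci => ?_⟩
  exact hjc.not_ge (hj.le_of_ge ⟨hj.prop.1.trans hjc.le, hci⟩ hjc.le)

lemma covBy_induction {T : Type*} [PartialOrder T] [Finite T] {P : T → T → Prop}
    (refl : ∀ i, P i i) (step : ∀ i j k, j ⋖ i → k ≤ j → P j k → P i k) {i k : T}
    (h : k ≤ i) : P i k := by
  induction i using WellFoundedLT.induction with | _ i ih =>
  rcases h.eq_or_lt with rfl | hlt
  · exact refl k
  · obtain ⟨j, hkj, hj⟩ := exists_le_covBy_of_lt_of_finite hlt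
    exact step i j k hj hkj (ih j hj.lt hkj)

lemma IsChain.exists_isGreatest {T : Type*} [PartialOrder T] [Finite T] {s : Set T}
    (hs : IsChain (· ≤ ·) s) (hne : s.Nonempty) : ∃ m, IsGreatest s m := by
  obtain ⟨m, hm⟩ := s.toFinite.exists_maximal hne
  refine ⟨m, hm.prop, fun k hk => ?_⟩
  rcases hs.total hk hm.prop with h | h
  · exact h
  · exact hm.le_of_ge hk h

section Glued

variable {T : Type*} {S : T → Type*} {Z : ∀ i, Set (S i)}

lemma sigma_eq_of_section (g : ∀ i, S i) {s t : (i : T) × Z i} (h : s.1 = t.1)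
    (hs : s.2.1 = g s.1) (ht : t.2.1 = g t.1) : s = t := by
  obtain ⟨i, a, ha⟩ := s
  obtain ⟨j, b, hb⟩ := t
  obtain rfl : i = j := h
  obtain rfl : a = g i := hs
  obtain rfl : b = g i := ht
  rfl

/-- Gluing automata `S i` along a compatible system of partial homomorphisms `Φ` gives a
Boolean-type retractable automaton, provided that a state on level `i` reaches all states on
levels below `i`. -/
lemma booleanTypeOn_glued [PartialOrder T] [Finite T]
    (hchain : ∀ i : T, IsChain (· ≤ ·) {j | j ≤ i}) (i₀ : T) (hbot : ∀ i, i₀ ≤ i)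
    (d : ∀ i, S i → X → S i) (Φ : ∀ i j, S i → S j)
    (hΦid : ∀ i a, Φ i i a = a)
    (hΦcomp : ∀ i j k, j ≤ i → k ≤ j → ∀ a, Φ j k (Φ i j a) = Φ i k a)
    (hΦmap : ∀ i k, k ≤ i → ∀ a ∈ Z i, Φ i k a ∈ Z k)
    (hΦhom : ∀ i k, k ≤ i → ∀ a ∈ Z i, ∀ x, d i a x ∈ Z i →
      d k (Φ i k a) x ∈ Z k ∧ d k (Φ i k a) x = Φ i k (d i a x))
    (D : ((i : T) × Z i) → X → ((i : T) × Z i))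
    (hD₁ : ∀ s x, IsGreatest {j | j ≤ s.1 ∧ d j (Φ s.1 j s.2.1) x ∈ Z j} (D s x).1)
    (hD₂ : ∀ s x, (D s x).2.1 = d (D s x).1 (Φ s.1 (D s x).1 s.2.1) x)
    (hreach : ∀ s t : (i : T) × Z i, t.1 ≤ s.1 → t ∈ Rset D s) :
    BooleanTypeOn D Set.univ := by
  have hlow : ∀ C, IsSubaut D C → ∀ s ∈ C, ∀ t : (i : T) × Z i, t.1 ≤ s.1 → t ∈ C :=
    fun C hC s hs t hts => hC.Rset_subset hs (hreach s t hts)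
  have hex : ∀ (C : Set ((i : T) × Z i)) (s : (i : T) × Z i), ∃ t : (i : T) × Z i,
      IsSubaut D C → IsGreatest {j | j ≤ s.1 ∧ ∃ a, ⟨j, a⟩ ∈ C} t.1 ∧
        t.2.1 = Φ s.1 t.1 s.2.1 := by
    intro C s
    by_cases hC : IsSubaut D C
    · obtain ⟨m, hm⟩ := ((hchain s.1).mono (s := {j | j ≤ s.1 ∧ ∃ a, ⟨j, a⟩ ∈ C})
        fun j hj => hj.1).exists_isGreatest (by
          obtain ⟨c, hc⟩ := hC.1
          exact ⟨i₀, hbot _, ⟨_, hΦmap c.1 i₀ (hbot _) c.2.1 c.2.2⟩, hlow C hC c hc _ (hbot _)⟩)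
      exact ⟨⟨m, _, hΦmap s.1 m hm.1.1 s.2.1 s.2.2⟩, fun _ => ⟨hm, rfl⟩⟩
    · exact ⟨s, fun h => absurd h hC⟩
  choose Λ hΛ using hex
  have hretr : ∀ C, IsSubaut D C → IsRetractHomOn D Set.univ C (Λ C) := by
    intro C hC
    refine ⟨fun s _ x => ?_, fun s _ => ?_, fun s hs => ?_⟩
    · obtain ⟨hu₁, hu₂⟩ := hΛ C (D s x) hC
      obtain ⟨ht₁, ht₂⟩ := hΛ C s hC
      obtain ⟨hv₁, hv₂⟩ := And.intro (hD₁ (Λ C s) x) (hD₂ (Λ C s) x)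
      obtain ⟨hw₁, hw₂⟩ := And.intro (hD₁ s x) (hD₂ s x)
      have hmem := hw₁.1.2
      have key := hΦhom _ _ hu₁.1.1 _ (hΦmap _ _ hw₁.1.1 _ s.2.2) x hmem
      rw [hΦcomp _ _ _ hw₁.1.1 hu₁.1.1] at key
      have hcomp : ∀ j ≤ (Λ C s).1, Φ (Λ C s).1 j (Λ C s).2.1 = Φ s.1 j s.2.1 := fun j hj => by
        rw [ht₂, hΦcomp _ _ _ ht₁.1.1 hj]
      refine sigma_eq_of_section (fun j => d j (Φ s.1 j s.2.1) x) ?_ ?_ ?_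
      · apply le_antisymm
        · have h : (Λ C (D s x)).1 ≤ (Λ C s).1 :=
            ht₁.2 ⟨hu₁.1.1.trans hw₁.1.1, hu₁.1.2⟩
          refine hv₁.2 ⟨h, ?_⟩
          rw [hcomp _ h]
          exact key.1
        · have h : (D (Λ C s) x).1 ≤ s.1 := hv₁.1.1.trans ht₁.1.1
          obtain ⟨a, ha⟩ := ht₁.1.2
          have hv := hv₁.1.2
          rw [hcomp _ hv₁.1.1] at hv
          exact hu₁.2 ⟨hw₁.2 ⟨h, hv⟩, (D (Λ C s) x).2, hlow C hC _ ha _ hv₁.1.1⟩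
      · rw [hu₂, key.2, hw₂]
      · rw [hv₂, hcomp _ hv₁.1.1]
    · obtain ⟨a, ha⟩ := (hΛ C s hC).1.1.2
      exact hlow C hC _ ha _ le_rfl
    · obtain ⟨ht₁, ht₂⟩ := hΛ C s hC
      exact sigma_eq_of_section (fun j => Φ s.1 j s.2.1)
        (le_antisymm ht₁.1.1 (ht₁.2 ⟨le_rfl, s.2, hs⟩)) ht₂ (hΦid _ _).symm
  refine ⟨fun C _ hC => ⟨Λ C, hretr C hC⟩, Λ, fun C _ hC => hretr C hC, ?_⟩
  intro C₁ C₂ hsub _ hC₁ hC₂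
  have hfac : ∀ s, Λ C₁ (Λ C₂ s) = Λ C₁ s := by
    intro s
    obtain ⟨ht₁, ht₂⟩ := hΛ C₂ s hC₂
    obtain ⟨hu₁, hu₂⟩ := hΛ C₁ (Λ C₂ s) hC₁
    obtain ⟨hv₁, hv₂⟩ := hΛ C₁ s hC₁
    refine sigma_eq_of_section (fun j => Φ s.1 j s.2.1) (le_antisymm ?_ ?_) ?_ hv₂
    · exact hv₁.2 ⟨hu₁.1.1.trans ht₁.1.1, hu₁.1.2⟩
    · obtain ⟨a, ha⟩ := hv₁.1.2
      exact hu₁.2 ⟨ht₁.2 ⟨hv₁.1.1, a, hsub ha⟩, a, ha⟩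
    · rw [hu₂, ht₂, hΦcomp _ _ _ ht₁.1.1 hu₁.1.1]
  intro s _ t _ h
  rw [← hfac s, ← hfac t, h]

lemma DeltaStar_glued {d : ∀ i, S i → X → S i}
    {D : ((i : T) × Z i) → X → ((i : T) × Z i)}
    (hstay : ∀ i (a : Z i) x (h : d i a.1 x ∈ Z i), D ⟨i, a⟩ x = ⟨i, d i a.1 x, h⟩)
    (htrap : ∀ i, ∀ c ∉ Z i, IsTrapT (d i) c) {i : T} (a b : Z i) (p : List X)
    (h : DeltaStar (d i) a.1 p = b.1) : DeltaStar D ⟨i, a⟩ p = ⟨i, b⟩ := by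
  induction p generalizing a with
  | nil =>
    obtain rfl : a = b := Subtype.ext h
    rfl
  | cons x p ih =>
    change DeltaStar (d i) (d i a.1 x) p = b.1 at h
    have hmem : d i a.1 x ∈ Z i := by
      by_contra hc
      rw [(htrap i _ hc).DeltaStar_eq] at h
      exact hc (h ▸ b.2)
    change DeltaStar D (D ⟨i, a⟩ x) p = _
    rw [hstay i a x hmem]
    exact ih _ h

end Glued

/-- The automaton `(A, X, δ')` built in the Construction from a finite
tree `T` with least element `i₀`, a family of pairwise disjoint state-finite automata
`A_i = (S i, X, d i)` (with `A_{i₀}` strongly connected and every other `A_i` strongly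
trap connected), partial homomorphisms `φ_{i,j} : A_i⁰ → A_j⁰` for covering pairs `j ⋖ i`
satisfying conditions (ii) and (iii), and their composites `Φ_{i,j}` along covering chains,
is a semi-connected Boolean-type retractable automaton containing a kernel. Here
`A = Σ i, A_i⁰` and `δ'` is the transition sending `a ∈ A_i⁰` and `x` to
`δ_{j*}(Φ_{i,j*}(a), x)` where `j*` is the greatest `j ≤ i` with `δ_j(Φ_{i,j}(a), x) ∈ A_j⁰`. -/
theorem construction_semiconnected_boolean_type
    {T : Type*} [PartialOrder T] [Finite T] {X : Type*} [Nonempty X]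
    (i₀ : T) (hbot : ∀ i, i₀ ≤ i)
    (hchain : ∀ i : T, IsChain (· ≤ ·) {j | j ≤ i})
    (S : T → Type*) [∀ i, Finite (S i)] [∀ i, Nonempty (S i)]
    (d : ∀ i, S i → X → S i)
    (hconn : StronglyConnT (d i₀))
    (htc : ∀ i, i ≠ i₀ → StronglyTrapConnT (d i))
    (φ : ∀ i j, S i → S j)
    (hφmap : ∀ i j, j ⋖ i → ∀ a ∈ ZeroPart (d i), φ i j a ∈ ZeroPart (d j))
    (hφhom : ∀ i j, j ⋖ i → ∀ a ∈ ZeroPart (d i), ∀ x, d i a x ∈ ZeroPart (d i) →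
      d j (φ i j a) x ∈ ZeroPart (d j) ∧ d j (φ i j a) x = φ i j (d i a x))
    (hφesc : ∀ i j, j ⋖ i → ∃ a ∈ ZeroPart (d i), ∃ x,
      d i a x ∉ ZeroPart (d i) ∧ d j (φ i j a) x ∈ ZeroPart (d j))
    (Φ : ∀ i j, S i → S j)
    (hΦid : ∀ i a, Φ i i a = a)
    (hΦstep : ∀ i j k, j ⋖ i → k ≤ j → ∀ a : S i, Φ i k a = Φ j k (φ i j a))
    (δ' : ((i : T) × ↥(ZeroPart (d i))) → X → ((i : T) × ↥(ZeroPart (d i))))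
    (hδ' : ∀ (i : T) (a : ↥(ZeroPart (d i))) (x : X),
      ∃ (j : T) (_ : j ≤ i) (hmem : d j (Φ i j a.1) x ∈ ZeroPart (d j)),
        (∀ k, k ≤ i → d k (Φ i k a.1) x ∈ ZeroPart (d k) → k ≤ j) ∧
        δ' ⟨i, a⟩ x = ⟨j, ⟨d j (Φ i j a.1) x, hmem⟩⟩) :
    SemiConnT δ' ∧ BooleanTypeOn δ' Set.univ ∧
      ∃ K : Set ((i : T) × ↥(ZeroPart (d i))), IsKernelOf δ' Set.univ K := by
  have hΦcov : ∀ i j, j ⋖ i → ∀ a : S i, Φ i j a = φ i j a := fun i j hj a => by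
    rw [hΦstep i j j hj le_rfl, hΦid]
  have hΦcomp : ∀ i j k, j ≤ i → k ≤ j → ∀ a, Φ j k (Φ i j a) = Φ i k a := by
    intro i j k hji hkj
    refine covBy_induction (P := fun i j => k ≤ j → ∀ a, Φ j k (Φ i j a) = Φ i k a)
      (fun i _ a => by rw [hΦid]) (fun i l j hl hjl ih hkj a => ?_) hji hkj
    rw [hΦstep i l j hl hjl, hΦstep i l k hl (hkj.trans hjl), ih hkj]
  have hΦmap : ∀ i k, k ≤ i → ∀ a ∈ ZeroPart (d i), Φ i k a ∈ ZeroPart (d k) := by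
    intro i k hki
    refine covBy_induction (P := fun i k => ∀ a ∈ ZeroPart (d i), Φ i k a ∈ ZeroPart (d k))
      (fun i a ha => by rwa [hΦid]) (fun i j k hj hkj ih a ha => ?_) hki
    rw [hΦstep i j k hj hkj]
    exact ih _ (hφmap i j hj a ha)
  have hΦhom : ∀ i k, k ≤ i → ∀ a ∈ ZeroPart (d i), ∀ x, d i a x ∈ ZeroPart (d i) →
      d k (Φ i k a) x ∈ ZeroPart (d k) ∧ d k (Φ i k a) x = Φ i k (d i a x) := by
    intro i k hki
    refine covBy_induction (P := fun i k => ∀ a ∈ ZeroPart (d i), ∀ x, d i a x ∈ ZeroPart (d i) →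
      d k (Φ i k a) x ∈ ZeroPart (d k) ∧ d k (Φ i k a) x = Φ i k (d i a x))
      (fun i a _ x h => by simpa only [hΦid, and_true] using h)
      (fun i j k hj hkj ih a ha x h => ?_) hki
    obtain ⟨h₁, h₂⟩ := hφhom i j hj a ha x h
    rw [hΦstep i j k hj hkj, hΦstep i j k hj hkj, ← h₂]
    exact ih _ (hφmap i j hj a ha) x h₁
  have hδ₁ : ∀ s x, IsGreatest {j | j ≤ s.1 ∧ d j (Φ s.1 j s.2.1) x ∈ ZeroPart (d j)}
      (δ' s x).1 := by
    rintro ⟨i, a⟩ x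
    obtain ⟨j, hj, hmem, hmax, heq⟩ := hδ' i a x
    rw [heq]
    exact ⟨⟨hj, hmem⟩, fun k hk => hmax k hk.1 hk.2⟩
  have hδ₂ : ∀ s x, (δ' s x).2.1 = d (δ' s x).1 (Φ s.1 (δ' s x).1 s.2.1) x := by
    rintro ⟨i, a⟩ x
    obtain ⟨j, hj, hmem, hmax, heq⟩ := hδ' i a x
    rw [heq]
  have hstay : ∀ i (a : ZeroPart (d i)) x (h : d i a.1 x ∈ ZeroPart (d i)),
      δ' ⟨i, a⟩ x = ⟨i, d i a.1 x, h⟩ := by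
    intro i a x h
    refine sigma_eq_of_section (fun j => d j (Φ i j a.1) x) ?_ (hδ₂ ⟨i, a⟩ x) ?_
    · exact le_antisymm (hδ₁ ⟨i, a⟩ x).1.1 ((hδ₁ ⟨i, a⟩ x).2 ⟨le_rfl, by rwa [hΦid]⟩)
    · simp only [hΦid]
  have hlevel : ∀ i (a b : ZeroPart (d i)), ∃ p : List X, p ≠ [] ∧
      DeltaStar δ' ⟨i, a⟩ p = ⟨i, b⟩ := by
    intro i a b
    obtain ⟨p, hp, h⟩ : ∃ p : List X, p ≠ [] ∧ DeltaStar (d i) a.1 p = b.1 := by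
      by_cases hi : i = i₀
      · subst hi
        exact hconn a.1 b.1
      · obtain ⟨j, -, hj⟩ :=
          exists_le_covBy_of_lt_of_finite (lt_of_le_of_ne (hbot i) (Ne.symm hi))
        obtain ⟨c, -, x, hc, -⟩ := hφesc i j hj
        exact (htc i hi).exists_word hc a.2 b.1
    exact ⟨p, hp, DeltaStar_glued hstay (fun i c hc => isTrapT_of_notMem_ZeroPart hc) a b p h⟩
  have hreach : ∀ s t : (i : T) × ZeroPart (d i), t.1 ≤ s.1 → t ∈ Rset δ' s := by
    rintro ⟨i, a⟩ ⟨k, b⟩ hki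
    refine covBy_induction (P := fun i k => ∀ (a : ZeroPart (d i)) (b : ZeroPart (d k)),
      (⟨k, b⟩ : (i : T) × ZeroPart (d i)) ∈ Rset δ' ⟨i, a⟩) (fun i a b => ?_)
      (fun i j k hj _ ih a b => ?_) hki a b
    · obtain ⟨p, -, hp⟩ := hlevel i a b
      exact ⟨p, hp⟩
    · obtain ⟨c, hc, x, hout, hin⟩ := hφesc i j hj
      obtain ⟨p, -, hp⟩ := hlevel i a ⟨c, hc⟩
      rw [← hΦcov i j hj] at hin
      obtain ⟨⟨hle, hmem⟩, hmax⟩ := hδ₁ ⟨i, c, hc⟩ x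
      have hmax' := hmax ⟨hj.le, hin⟩
      have hlevel_eq : (δ' ⟨i, c, hc⟩ x).1 = j := by
        rcases hj.eq_or_eq hmax' hle with h | h
        · exact h
        · rw [h, hΦid] at hmem
          exact absurd hmem hout
      have hstep : δ' ⟨i, c, hc⟩ x ∈ Rset δ' ⟨i, a⟩ := Rset_closed δ' _ ⟨p, hp⟩ x
      generalize δ' ⟨i, c, hc⟩ x = e at hlevel_eq hstep
      obtain ⟨l, e⟩ := e
      obtain rfl : l = j := hlevel_eq
      exact Rset_mono δ' hstep (ih e b)
  refine ⟨semiConnT_of_loops δ' fun s => hlevel s.1 s.2 s.2,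
    booleanTypeOn_glued hchain i₀ hbot d Φ hΦid hΦcomp hΦmap hΦhom δ' hδ₁ hδ₂ hreach,
    {s | s.1 = i₀}, ⟨?_, ?_⟩, Set.subset_univ _, ?_⟩
  · obtain ⟨a⟩ := ‹∀ i, Nonempty (S i)› i₀
    exact ⟨⟨i₀, a, hconn.mem_ZeroPart a⟩, rfl⟩
  · rintro s hs x
    exact le_antisymm ((hδ₁ s x).1.1.trans_eq hs) (hbot _)
  · rintro C - hC s hs
    obtain ⟨c, hc⟩ := hC.1
    exact hC.Rset_subset hc (hreach c s ((show s.1 = i₀ from hs) ▸ hbot c.1))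
end
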